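/- Let q be an odd prime power. Then the irreducible complex characters of GL_2(𝔽_q) are distributed by degree as follows: there are exactly q−1 of degree 1, exactly q−1 of degree q, exactly (q−1)(q−2)/2 of degree q+1, and exactly q(q−1)/2 of degree q−1; in total GL_2(𝔽_q) has q² − 1 irreducible complex characters. -/

import Mathlib

open CategoryTheory Matrix

/-- The irreducible complex characters of a group. -/
abbrev IrrChar (G : Type) [Group G] : Type :=
  {χ : G → ℂ // ∃ V : FDRep ℂ G, Simple V ∧ χ = V.character}

namespace IrrChar

section

open Representation

variable {G : Type} [Group G] [Fintype G]

omit [Fintype G] in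
theorem map_conj (χ : IrrChar G) (g x : G) : χ.1 (x * g * x⁻¹) = χ.1 g := by
  obtain ⟨χ, V, hV, rfl⟩ := χ
  exact V.char_conj g x

open scoped Classical in
theorem sum_mul_inv (χ χ' : IrrChar G) :
    ∑ g, χ.1 g * χ'.1 g⁻¹ = if χ = χ' then (Nat.card G : ℂ) else 0 := by
  have hne : (Nat.card G : ℂ) ≠ 0 := by simp
  have := invertibleOfNonzero hne
  split_ifs with h
  · subst h
    obtain ⟨χ, V, hV, rfl⟩ := χ
    exact V.simple_iff_char_is_norm_one.1 hV
  · obtain ⟨χ, V, hV, rfl⟩ := χ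
    obtain ⟨χ', V', hV', rfl⟩ := χ'
    have h1 := FDRep.char_orthonormal V V'
    rw [if_neg] at h1
    · simpa using h1
    · rintro ⟨i⟩
      exact h (Subtype.ext (FDRep.char_iso i))

theorem linearIndependent : LinearIndependent ℂ (fun χ : IrrChar G => χ.1) := by
  classical
  rw [linearIndependent_iff']
  intro s c hc χ hχ
  have h1 : ∑ g, (∑ i ∈ s, c i • i.1) g * χ.1 g⁻¹ = 0 := by
    rw [hc]
    simp
  simp only [Finset.sum_apply, Pi.smul_apply, smul_eq_mul, Finset.sum_mul, mul_assoc] at h1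
  rw [Finset.sum_comm] at h1
  simp only [← Finset.mul_sum, sum_mul_inv] at h1
  simpa [hχ] using h1

instance : Finite (IrrChar G) := linearIndependent.finite

noncomputable instance : Fintype (IrrChar G) := Fintype.ofFinite _

section SimpleModule

variable (M : Type) [AddCommGroup M] [Module ℂ M] [Module (MonoidAlgebra ℂ G) M]
  [IsScalarTower ℂ (MonoidAlgebra ℂ G) M] [FiniteDimensional ℂ M]
  [IsSimpleModule (MonoidAlgebra ℂ G) M]

omit [Fintype G] in
theorem exists_eq_smul_one (T : M →ₗ[ℂ] M)
    (hT : ∀ g m, T (ofModule' (k := ℂ) (G := G) M g m) = ofModule' (k := ℂ) (G := G) M g (T m)) :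
    ∃ c : ℂ, T = c • 1 := by
  obtain ⟨c, hc⟩ := (IsSimpleModule.algebraMap_end_bijective_of_isAlgClosed ℂ
    (A := MonoidAlgebra ℂ G) (V := M)).2 (MonoidAlgebra.equivariantOfLinearOfComm T hT)
  refine ⟨c, LinearMap.ext fun m => ?_⟩
  exact (LinearMap.congr_fun hc m).symm

/-- The character of a simple module over the group algebra, as an irreducible character. -/
noncomputable def ofSimpleModule : IrrChar G :=
  ⟨(ofModule' (k := ℂ) (G := G) M).character, FDRep.of (ofModule' (k := ℂ) (G := G) M), by
    have hne : (Nat.card G : ℂ) ≠ 0 := by simp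
    have := invertibleOfNonzero hne
    have := IsSimpleModule.nontrivial (MonoidAlgebra ℂ G) M
    set ρ := ofModule' (k := ℂ) (G := G) M
    rw [FDRep.simple_iff_char_is_norm_one]
    have h1 := card_inv_mul_sum_char_mul_char_eq_finrank ρ ρ
    have hone : (IntertwiningMap.id ρ) ≠ 0 := by
      intro h
      obtain ⟨m, hm⟩ := exists_ne (0 : M)
      exact hm (congrArg (fun T : IntertwiningMap ρ ρ => T.toLinearMap m) h)
    rw [(finrank_eq_one_iff_of_nonzero' _ hone).2, Nat.cast_one, inv_mul_eq_one₀ hne] at h1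
    · exact h1.symm
    · intro T
      obtain ⟨c, hc⟩ := exists_eq_smul_one (G := G) M T.toLinearMap
        fun g m => LinearMap.congr_fun (T.isIntertwining' g) m
      refine ⟨c, IntertwiningMap.toLinearMap_injective _ _ ?_⟩
      exact hc.symm, rfl⟩

end SimpleModule

variable {f : G → ℂ} (hf : ∀ g x, f (x * g * x⁻¹) = f g)
  (hχ : ∀ χ : IrrChar G, ∑ g, f g * χ.1 g⁻¹ = 0)
include hf hχ

theorem sum_smul_eq_zero (M : Type) [AddCommGroup M] [Module ℂ M] [Module (MonoidAlgebra ℂ G) M]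
    [IsScalarTower ℂ (MonoidAlgebra ℂ G) M] [FiniteDimensional ℂ M]
    [IsSimpleModule (MonoidAlgebra ℂ G) M] :
    ∑ g, f g • ofModule' (k := ℂ) (G := G) M g⁻¹ = 0 := by
  set ρ := ofModule' (k := ℂ) (G := G) M
  set T : M →ₗ[ℂ] M := ∑ g, f g • ρ g⁻¹ with hT
  have hcomm (x : G) : T * ρ x = ρ x * T := by
    rw [hT, Finset.sum_mul, Finset.mul_sum]
    refine Fintype.sum_equiv (MulAut.conj x⁻¹).toEquiv _ _ fun g => ?_
    simp only [MulEquiv.toEquiv_eq_coe, EquivLike.coe_coe, MulAut.conj_apply, hf, smul_mul_assoc,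
      mul_smul_comm, ← map_mul]
    simp [← mul_assoc]
  obtain ⟨c, hTc⟩ := exists_eq_smul_one (G := G) M T fun g => LinearMap.congr_fun (hcomm g)
  have htr : LinearMap.trace ℂ M T = 0 := by
    rw [← hχ (ofSimpleModule M), hT, map_sum]
    simp [ofSimpleModule, Representation.character, ρ]
  have := IsSimpleModule.nontrivial (MonoidAlgebra ℂ G) M
  rw [hTc, map_smul, LinearMap.trace_one, smul_eq_mul, mul_eq_zero] at htr
  rw [hTc, htr.resolve_right (by simpa using Module.finrank_pos.ne'), zero_smul]

theorem eq_zero_of_sum_mul_eq_zero : f = 0 := by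
  set e : MonoidAlgebra ℂ G := ∑ g, f g • MonoidAlgebra.of ℂ G g⁻¹ with he
  have he0 : e • (1 : MonoidAlgebra ℂ G) = 0 := by
    have h1 : (1 : MonoidAlgebra ℂ G) ∈
        sSup {S : Submodule (MonoidAlgebra ℂ G) (MonoidAlgebra ℂ G) |
          IsSimpleModule (MonoidAlgebra ℂ G) S} := by
      rw [IsSemisimpleModule.sSup_simples_eq_top]
      trivial
    rw [sSup_eq_iSup'] at h1
    refine Submodule.iSup_induction _ (motive := fun x => e • x = 0) h1 (fun S x hx => ?_)
      (smul_zero e) (fun x y hx hy => by rw [smul_add, hx, hy, add_zero])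
    obtain ⟨S, hS⟩ := S
    rw [Set.mem_ofPred_eq] at hS
    have : FiniteDimensional ℂ S := Module.Finite.trans (MonoidAlgebra ℂ G) S
    have h2 := LinearMap.congr_fun (sum_smul_eq_zero hf hχ S) ⟨x, hx⟩
    rw [he, Finset.sum_smul]
    simpa [ofModule', smul_assoc, -MonoidAlgebra.smul_single] using congrArg Subtype.val h2
  rw [smul_eq_mul, mul_one] at he0
  funext g
  have := congrArg (fun a : MonoidAlgebra ℂ G => a.coeff g⁻¹) he0
  classical
  simpa [he, Finsupp.single_apply] using this

omit hf hχ in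
open scoped Classical in
theorem sum_inv_mul (g h : G) :
    ∑ χ : IrrChar G, χ.1 g⁻¹ * χ.1 h = ∑ x : G, if x * g * x⁻¹ = h then 1 else 0 := by
  have key := eq_zero_of_sum_mul_eq_zero
    (f := fun h => (∑ x : G, if x * g * x⁻¹ = h then 1 else 0) -
      ∑ χ : IrrChar G, χ.1 g⁻¹ * χ.1 h) (fun h x => ?_) (fun χ => ?_)
  · exact (sub_eq_zero.1 (congrFun key h)).symm
  · simp only [map_conj]
    congr 1
    refine (Fintype.sum_equiv (Equiv.mulLeft x) _ _ fun y => ?_).symm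
    have : x * y * g * (x * y)⁻¹ = x * h * x⁻¹ ↔ y * g * y⁻¹ = h := by
      rw [show x * y * g * (x * y)⁻¹ = x * (y * g * y⁻¹) * x⁻¹ by group, mul_left_inj, mul_right_inj]
    simp only [Equiv.coe_mulLeft, this]
  · simp only [sub_mul, Finset.sum_sub_distrib, Finset.sum_mul, mul_assoc]
    rw [Finset.sum_comm, Finset.sum_comm (s := Finset.univ (α := G)) (t := Finset.univ (α := IrrChar G))]
    simp only [← Finset.mul_sum, sum_mul_inv]
    have (y : G) : χ.1 (y * g⁻¹ * y⁻¹) = χ.1 g⁻¹ := χ.map_conj _ _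
    simp [this, mul_comm]

omit hf hχ in
theorem card_eq : Fintype.card (IrrChar G) = Nat.card (ConjClasses G) := by
  classical
  have h1 : ∑ g : G, ∑ χ : IrrChar G, χ.1 g⁻¹ * χ.1 g = Nat.card G * Fintype.card (IrrChar G) := by
    rw [Finset.sum_comm]
    simp_rw [fun χ : IrrChar G => fun g => mul_comm (χ.1 g⁻¹) (χ.1 g), sum_mul_inv]
    simp [mul_comm]
  have h2 : ∑ g : G, ∑ χ : IrrChar G, χ.1 g⁻¹ * χ.1 g =
      (Nat.card {p : G × G // Commute p.1 p.2} : ℂ) := by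
    simp_rw [sum_inv_mul]
    rw [Nat.card_eq_fintype_card, Fintype.card_subtype, ← Fintype.sum_prod_type', Finset.sum_boole]
    simp only [mul_inv_eq_iff_eq_mul, Commute, SemiconjBy]
    simp only [eq_comm]
    norm_cast
  rw [h1, card_comm_eq_card_conjClasses_mul_card] at h2
  have h3 : Nat.card G * Fintype.card (IrrChar G) = Nat.card (ConjClasses G) * Nat.card G := by
    exact_mod_cast h2
  rw [mul_comm] at h3
  exact Nat.eq_of_mul_eq_mul_right Nat.card_pos h3

omit hf hχ [Fintype G] in
theorem exists_natCast_sum_twist {H : Type} [Group H] [Fintype H] (φ : H →* G) (ψ : H →* ℂˣ)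
    (χ : IrrChar G) : ∃ n : ℕ, (Nat.card H : ℂ)⁻¹ * ∑ h, ((ψ h)⁻¹ : ℂˣ) * χ.1 (φ h) = n := by
  obtain ⟨χ, V, hV, rfl⟩ := χ
  have := invertibleOfNonzero (show (Nat.card H : ℂ) ≠ 0 by simp)
  let ρ : Representation ℂ H V :=
    { toFun := fun h => (((ψ h)⁻¹ : ℂˣ) : ℂ) • V.ρ (φ h)
      map_one' := by simp
      map_mul' := fun a b => by
        simp only [map_mul, mul_inv, Units.val_mul, smul_mul_smul_comm] }
  refine ⟨_, Eq.trans ?_ (card_inv_mul_sum_char_eq_finrank ρ)⟩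
  simp [ρ, Representation.character, FDRep.character]

omit hf hχ in
theorem exists_natCast_apply_one (χ : IrrChar G) : ∃ n : ℕ, 0 < n ∧ χ.1 1 = n := by
  obtain ⟨χ, V, hV, rfl⟩ := χ
  refine ⟨_, Nat.pos_of_ne_zero fun h => ?_, V.char_one⟩
  have h1 := V.simple_iff_char_is_norm_one.1 hV
  have : Subsingleton V := Module.finrank_zero_iff.1 h
  have h2 (g : G) : V.character g = 0 := by
    rw [FDRep.character, Subsingleton.elim (V.ρ g) 0, map_zero]
  simp only [h2, mul_zero, Finset.sum_const_zero] at h1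
  simp at h1
  exact Fintype.card_ne_zero (by exact_mod_cast h1.symm)

omit hf hχ in
/-- A homomorphism to `ℂˣ`, as an irreducible character. -/
noncomputable def ofHom (ψ : G →* ℂˣ) : IrrChar G :=
  let ρ : Representation ℂ G ℂ := (Algebra.lmul ℂ ℂ).toMonoidHom.comp ((Units.coeHom ℂ).comp ψ)
  have h (g : G) : (FDRep.of ρ).character g = ψ g := by
    change LinearMap.trace ℂ ℂ (LinearMap.mulLeft ℂ (ψ g : ℂ)) = _
    rw [show LinearMap.mulLeft ℂ (ψ g : ℂ) = (ψ g : ℂ) • 1 from LinearMap.ext fun x => by simp]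
    simp
  ⟨fun g => ψ g, FDRep.of ρ, by
    rw [FDRep.simple_iff_char_is_norm_one]
    simp [h], (funext h).symm⟩

section Multiplicity

omit hf hχ

theorem sum_apply_one_sq : ∑ χ : IrrChar G, χ.1 1 ^ 2 = Nat.card G := by
  have := sum_inv_mul (1 : G) 1
  simpa [sq] using this

variable {H : Type} [Group H] [Fintype H] (φ : H →* G) (ψ ψ' : H →* ℂˣ) (χ : IrrChar G)

/-- The multiplicity of the linear character `ψ` in the pullback of `χ` along `φ`. -/
noncomputable def mult : ℕ := (exists_natCast_sum_twist φ ψ χ).choose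

omit [Fintype G] in
theorem mult_eq :
    (mult φ ψ χ : ℂ) = (Nat.card H : ℂ)⁻¹ * ∑ h, ((ψ h)⁻¹ : ℂˣ) * χ.1 (φ h) :=
  (exists_natCast_sum_twist φ ψ χ).choose_spec.symm

omit [Fintype G] in
theorem mult_eq_sum_inv :
    (mult φ ψ χ : ℂ) = (Nat.card H : ℂ)⁻¹ * ∑ h, (ψ h : ℂ) * χ.1 (φ h)⁻¹ := by
  rw [mult_eq]
  congr 1
  exact Fintype.sum_equiv (Equiv.inv H) _ _ fun h => by simp

theorem sum_mult_mul_apply_one (hφ : Function.Injective φ) :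
    ∑ χ : IrrChar G, (mult φ ψ χ : ℂ) * χ.1 1 = (Nat.card H : ℂ)⁻¹ * Nat.card G := by
  classical
  have h1 (h : H) := sum_inv_mul (1 : G) (φ h)
  simp only [inv_one, mul_one, mul_inv_cancel] at h1
  have h2 (h : H) : 1 = φ h ↔ h = 1 := by
    rw [eq_comm, map_eq_one_iff φ hφ]
  calc _ = (Nat.card H : ℂ)⁻¹ * ∑ h, ((ψ h)⁻¹ : ℂˣ) * ∑ χ : IrrChar G, χ.1 1 * χ.1 (φ h) := by
        simp_rw [mult_eq, Finset.mul_sum, Finset.sum_mul]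
        rw [Finset.sum_comm]
        exact Finset.sum_congr rfl fun h _ => Finset.sum_congr rfl fun χ _ => by ring
    _ = _ := by simp [h1, h2]

open scoped Classical in
theorem sum_mult_mul_mult :
    ∑ χ : IrrChar G, (mult φ ψ χ : ℂ) * mult φ ψ' χ =
      (Nat.card H : ℂ)⁻¹ ^ 2 * ∑ h', (ψ' h' : ℂ) *
        ∑ x : G, ∑ h, if x * φ h' * x⁻¹ = φ h then (((ψ h)⁻¹ : ℂˣ) : ℂ) else 0 := by
  simp_rw [mult_eq φ ψ, mult_eq_sum_inv φ ψ', mul_mul_mul_comm, ← Finset.mul_sum, ← sq]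
  congr 1
  have h1 (h' h : H) := sum_inv_mul (φ h') (φ h)
  calc _ = ∑ h', (ψ' h' : ℂ) *
          ∑ h, ((ψ h)⁻¹ : ℂˣ) * ∑ χ : IrrChar G, χ.1 (φ h')⁻¹ * χ.1 (φ h) := by
        simp_rw [Finset.sum_mul_sum, Finset.mul_sum]
        rw [Finset.sum_comm_cycle]
        refine Finset.sum_congr rfl fun h' _ => ?_
        rw [Finset.sum_comm]
        exact Finset.sum_congr rfl fun h _ => Finset.sum_congr rfl fun χ _ => by ring
    _ = _ := by
        refine Finset.sum_congr rfl fun h' _ => ?_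
        simp_rw [h1, Finset.mul_sum]
        rw [Finset.sum_comm]
        simp

end Multiplicity

end

end IrrChar

namespace GLTwo

section

variable {F : Type} [Field F]

theorem mul_sub_mul_ne_zero (g : GL (Fin 2) F) : g 0 0 * g 1 1 - g 0 1 * g 1 0 ≠ 0 := by
  rw [← Matrix.det_fin_two]
  exact g.det.ne_zero

variable (F) in
/-- The upper triangular matrices in `GL₂(F)`. -/
def borel : Subgroup (GL (Fin 2) F) where
  carrier := {g | g 1 0 = 0}
  one_mem' := by simp
  mul_mem' {a b} ha hb := by
    simp only [Set.mem_ofPred_eq] at *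
    simp [Matrix.mul_apply, Fin.sum_univ_two, ha, hb]
  inv_mem' {a} ha := by
    simp only [Set.mem_ofPred_eq] at *
    simp [Matrix.coe_units_inv, Matrix.inv_def, Matrix.adjugate_fin_two, ha]

theorem mem_borel {g : GL (Fin 2) F} : g ∈ borel F ↔ g 1 0 = 0 := Iff.rfl

/-- The upper left entry of an upper triangular matrix. -/
def borelFst : borel F →* Fˣ :=
  MonoidHom.toHomUnits
    { toFun := fun g => g.1 0 0
      map_one' := by simp
      map_mul' := fun g h => by
        have := mem_borel.1 h.2
        simp [Matrix.mul_apply, Fin.sum_univ_two, this] }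

/-- The lower right entry of an upper triangular matrix. -/
def borelSnd : borel F →* Fˣ :=
  MonoidHom.toHomUnits
    { toFun := fun g => g.1 1 1
      map_one' := by simp
      map_mul' := fun g h => by
        have := mem_borel.1 g.2
        simp [Matrix.mul_apply, Fin.sum_univ_two, this] }

@[simp] theorem coe_borelFst (g : borel F) : (borelFst g : F) = g.1 0 0 := rfl
@[simp] theorem coe_borelSnd (g : borel F) : (borelSnd g : F) = g.1 1 1 := rfl

/-- Coordinates on the group of upper triangular matrices. -/
noncomputable def borelEquiv : Fˣ × Fˣ × F ≃ borel F where
  toFun p := ⟨GeneralLinearGroup.mkOfDetNeZero !![(p.1 : F), p.2.2; 0, p.2.1]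
    (by simp [Matrix.det_fin_two]), by
      rw [mem_borel]; simp [GeneralLinearGroup.mkOfDetNeZero]⟩
  invFun g := (borelFst g, borelSnd g, g.1 0 1)
  left_inv p := by
    ext <;> simp [GeneralLinearGroup.mkOfDetNeZero]
  right_inv g := by
    have := mem_borel.1 g.2
    ext i j
    fin_cases i <;> fin_cases j <;> simp [GeneralLinearGroup.mkOfDetNeZero, this]

@[simp] theorem borelFst_borelEquiv (p : Fˣ × Fˣ × F) : borelFst (borelEquiv p) = p.1 :=
  congrArg Prod.fst (borelEquiv.left_inv p)

@[simp] theorem borelSnd_borelEquiv (p : Fˣ × Fˣ × F) : borelSnd (borelEquiv p) = p.2.1 :=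
  congrArg (fun p => p.2.1) (borelEquiv.left_inv p)

theorem coe_borelEquiv (p : Fˣ × Fˣ × F) :
    ((borelEquiv p).1 : Matrix (Fin 2) (Fin 2) F) = !![(p.1 : F), p.2.2; 0, p.2.1] := rfl

/-- The linear character of the upper triangular group attached to two characters of `Fˣ`. -/
def borelChar (p : (Fˣ →* ℂˣ) × (Fˣ →* ℂˣ)) : borel F →* ℂˣ :=
  p.1.comp borelFst * p.2.comp borelSnd

@[simp] theorem borelChar_borelEquiv (p : (Fˣ →* ℂˣ) × (Fˣ →* ℂˣ)) (b : Fˣ × Fˣ × F) :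
    borelChar p (borelEquiv b) = p.1 b.1 * p.2 b.2.1 := by simp [borelChar]

/-- Representatives of the nontrivial right cosets of the upper triangular group. -/
noncomputable def cosetRep (t : F) : GL (Fin 2) F :=
  GeneralLinearGroup.mkOfDetNeZero !![0, 1; 1, t] (by simp [Matrix.det_fin_two])

theorem coe_cosetRep (t : F) : (cosetRep t : Matrix (Fin 2) (Fin 2) F) = !![0, 1; 1, t] := rfl

theorem coe_cosetRep_inv (t : F) :
    ((cosetRep t)⁻¹ : GL (Fin 2) F) = (!![-t, 1; 1, 0] : Matrix (Fin 2) (Fin 2) F) := by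
  rw [Matrix.coe_units_inv, coe_cosetRep]
  simp [Matrix.inv_def, Matrix.adjugate_fin_two, Matrix.det_fin_two]

theorem coe_cosetRep_conj (t : F) (b : Fˣ × Fˣ × F) :
    ((cosetRep t * (borelEquiv b).1 * (cosetRep t)⁻¹ : GL (Fin 2) F) :
      Matrix (Fin 2) (Fin 2) F) = !![(b.2.1 : F), 0; b.2.2 + t * (b.2.1 - b.1), b.1] := by
  rw [Units.val_mul, Units.val_mul, coe_cosetRep, coe_cosetRep_inv, coe_borelEquiv]
  ext i j
  fin_cases i <;> fin_cases j <;> simp [Matrix.mul_apply, Fin.sum_univ_two]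
  ring

variable [Fintype F] [DecidableEq F]

theorem card_borel : Nat.card (borel F) = (Fintype.card F - 1) ^ 2 * Fintype.card F := by
  rw [← Nat.card_congr borelEquiv]
  simp [Fintype.card_units]
  ring

theorem card_GLTwo :
    Nat.card (GL (Fin 2) F) = Nat.card (borel F) * (Fintype.card F + 1) := by
  obtain ⟨n, hn⟩ : ∃ n, Fintype.card F = n + 1 := ⟨_, (Nat.succ_pred Fintype.card_ne_zero).symm⟩
  rw [card_borel, Matrix.card_GL_field]
  simp only [Fin.prod_univ_two, Fin.val_zero, Fin.val_one, hn]
  have h1 : (n + 1) ^ 2 - (n + 1) ^ 0 = n * (n + 2) := by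
    rw [Nat.sub_eq_iff_eq_add (by simp [Nat.one_le_pow])]; ring
  have h2 : (n + 1) ^ 2 - (n + 1) ^ 1 = n * (n + 1) := by
    rw [Nat.sub_eq_iff_eq_add (by nlinarith)]; ring
  rw [h1, h2, Nat.add_sub_cancel]
  ring

theorem bijective_bruhat : Function.Bijective
    (Sum.elim (fun b : borel F => b.1) (fun p : borel F × F => p.1.1 * cosetRep p.2)) := by
  classical
  rw [Fintype.bijective_iff_surjective_and_card]
  refine ⟨fun g => ?_, ?_⟩
  · by_cases hg : g 1 0 = 0
    · exact ⟨Sum.inl ⟨g, hg⟩, rfl⟩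
    · refine ⟨Sum.inr (⟨g * (cosetRep (g 1 1 / g 1 0))⁻¹, ?_⟩, g 1 1 / g 1 0), by simp⟩
      rw [mem_borel, Units.val_mul, coe_cosetRep_inv]
      simp [Matrix.mul_apply, Fin.sum_univ_two]
      field_simp
      ring
  · rw [Fintype.card_sum, Fintype.card_prod, ← Nat.card_eq_fintype_card,
      ← Nat.card_eq_fintype_card (α := GL (Fin 2) F), card_GLTwo]
    ring

end

end GLTwo

namespace GLTwo

section

variable {F : Type} [Field F] [Fintype F] [DecidableEq F]

noncomputable instance : Fintype (borel F) := Fintype.ofFinite _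

section BorelExt

variable (p : (Fˣ →* ℂˣ) × (Fˣ →* ℂˣ))

omit [DecidableEq F] in
open scoped Classical in
/-- The inverse of `borelChar p`, extended by zero to `GL₂(F)`. -/
noncomputable def borelExt (g : GL (Fin 2) F) : ℂ :=
  ∑ h : borel F, if g = (borel F).subtype h then (((borelChar p h)⁻¹ : ℂˣ) : ℂ) else 0

theorem borelExt_coe (h : borel F) : borelExt p h.1 = ((borelChar p h)⁻¹ : ℂˣ) := by
  simp [borelExt]

theorem borelExt_of_notMem {g : GL (Fin 2) F} (hg : g ∉ borel F) : borelExt p g = 0 := by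
  refine Finset.sum_eq_zero fun h _ => if_neg ?_
  rintro rfl
  exact hg h.2

theorem borelExt_conj (b : borel F) (g : GL (Fin 2) F) :
    borelExt p (b.1 * g * b.1⁻¹) = borelExt p g := by
  by_cases hg : g ∈ borel F
  · have h1 := borelExt_coe p ⟨g, hg⟩
    have h2 := borelExt_coe p (b * ⟨g, hg⟩ * b⁻¹)
    exact (h2.trans (by simp)).trans h1.symm
  · rw [borelExt_of_notMem p hg, borelExt_of_notMem]
    intro h
    refine hg ?_
    have := (borel F).mul_mem ((borel F).mul_mem (inv_mem b.2) h) b.2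
    simpa [mul_assoc] using this

theorem borelExt_cosetRep_conj (t : F) (b : Fˣ × Fˣ × F) :
    borelExt p (cosetRep t * (borelEquiv b).1 * (cosetRep t)⁻¹) =
      if b.2.2 = t * (b.1 - b.2.1) then (((p.1 b.2.1 * p.2 b.1)⁻¹ : ℂˣ) : ℂ) else 0 := by
  have hc := coe_cosetRep_conj t b
  split_ifs with h
  · have : cosetRep t * (borelEquiv b).1 * (cosetRep t)⁻¹ =
        (borelEquiv (b.2.1, b.1, (0 : F))).1 := by
      refine Units.ext ?_
      rw [hc, coe_borelEquiv, h]
      congr!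
      ring
    rw [this, borelExt_coe, borelChar_borelEquiv]
  · refine borelExt_of_notMem p fun hm => h ?_
    rw [mem_borel, hc] at hm
    have hm' : b.2.2 + t * (b.2.1 - b.1) = 0 := hm
    linear_combination hm'

theorem sum_borelExt_conj (b : Fˣ × Fˣ × F) :
    ∑ x : GL (Fin 2) F, borelExt p (x * (borelEquiv b).1 * x⁻¹) =
      Nat.card (borel F) * ((((p.1 b.1 * p.2 b.2.1)⁻¹ : ℂˣ) : ℂ) +
        ∑ t, if b.2.2 = t * (b.1 - b.2.1) then (((p.1 b.2.1 * p.2 b.1)⁻¹ : ℂˣ) : ℂ) else 0) := by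
  have h (c : borel F) (t : F) : c.1 * cosetRep t * (borelEquiv b).1 * (c.1 * cosetRep t)⁻¹ =
      c.1 * (cosetRep t * (borelEquiv b).1 * (cosetRep t)⁻¹) * c.1⁻¹ := by group
  rw [← bijective_bruhat.sum_comp, Fintype.sum_sum_type, Fintype.sum_prod_type]
  simp only [Sum.elim_inl, Sum.elim_inr, h, borelExt_conj, borelExt_cosetRep_conj]
  rw [borelExt_coe, borelChar_borelEquiv]
  simp [mul_add]

end BorelExt

theorem ite_mul_ite_eq {R : Type*} [CommSemiring R] (P Q : Prop) [Decidable P] [Decidable Q]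
    [Decidable (P ∧ Q)] (x : R) :
    (if P then x else 0) * (if Q then x else 0) = x ^ 2 * if P ∧ Q then 1 else 0 := by
  by_cases hP : P <;> by_cases hQ : Q <;> simp [hP, hQ, sq]

open scoped Classical in
theorem sum_mul_inv_char (α γ : Fˣ →* ℂˣ) :
    ∑ a, (γ a : ℂ) * ((α a)⁻¹ : ℂˣ) = if γ = α then (Fintype.card F - 1 : ℂ) else 0 := by
  have h := sum_hom_units ((Units.coeHom ℂ).comp (γ * α⁻¹))
  have h1 : (Units.coeHom ℂ).comp (γ * α⁻¹) = 1 ↔ γ = α := by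
    rw [← mul_inv_eq_one (a := γ)]
    refine ⟨fun h => MonoidHom.ext fun a => Units.ext (DFunLike.congr_fun h a), fun h => ?_⟩
    rw [h]; rfl
  simp only [h1, Fintype.card_units] at h
  rw [Nat.cast_ite, Nat.cast_sub Fintype.card_pos, Nat.cast_one] at h
  simpa using h

open scoped Classical in
theorem sum_mult_borelChar (p p' : (Fˣ →* ℂˣ) × (Fˣ →* ℂˣ)) :
    ∑ χ, IrrChar.mult (borel F).subtype (borelChar p) χ *
      IrrChar.mult (borel F).subtype (borelChar p') χ =
        (if p' = p then 1 else 0) + if p' = p.swap then 1 else 0 := by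
  have key := IrrChar.sum_mult_mul_mult (borel F).subtype (borelChar p) (borelChar p')
  have h0 : (Nat.card (borel F) : ℂ) = (Fintype.card F - 1) ^ 2 * Fintype.card F := by
    rw [card_borel, Nat.cast_mul, Nat.cast_pow, Nat.cast_sub Fintype.card_pos, Nat.cast_one]
  have hB : (Nat.card (borel F) : ℂ) ≠ 0 := by simp
  have h1 (a d : Fˣ) : ∑ x : F, (borelChar p' (borelEquiv (a, d, x)) : ℂ) *
      ∑ g : GL (Fin 2) F, borelExt p (g * (borelEquiv (a, d, x)).1 * g⁻¹) =
      Nat.card (borel F) * Fintype.card F *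
        (((p'.1 a : ℂ) * ((p.1 a)⁻¹ : ℂˣ)) * ((p'.2 d : ℂ) * ((p.2 d)⁻¹ : ℂˣ)) +
          ((p'.1 a : ℂ) * ((p.2 a)⁻¹ : ℂˣ)) * ((p'.2 d : ℂ) * ((p.1 d)⁻¹ : ℂˣ))) := by
    simp only [sum_borelExt_conj, borelChar_borelEquiv]
    rw [← Finset.mul_sum, ← Finset.mul_sum, Finset.sum_add_distrib, Finset.sum_comm]
    simp
    ring
  have h2 : ∑ h', (borelChar p' h' : ℂ) *
      ∑ x : GL (Fin 2) F, borelExt p (x * h'.1 * x⁻¹) =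
      Nat.card (borel F) * Fintype.card F * (Fintype.card F - 1) ^ 2 *
        ((if p' = p then 1 else 0) + if p' = p.swap then 1 else 0) := by
    rw [← borelEquiv.sum_comp, Fintype.sum_prod_type]
    refine (Finset.sum_congr rfl fun a _ => (Fintype.sum_prod_type _).trans
      (Finset.sum_congr rfl fun d _ => h1 a d)).trans ?_
    simp only [← Finset.mul_sum, Finset.sum_add_distrib]
    simp only [← Finset.sum_mul]
    rw [sum_mul_inv_char, sum_mul_inv_char, sum_mul_inv_char, sum_mul_inv_char,
      mul_assoc (_ * _) (_ ^ 2)]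
    congr 1
    simp only [Prod.ext_iff, Prod.fst_swap, Prod.snd_swap]
    rw [ite_mul_ite_eq, ite_mul_ite_eq, mul_add]
  have h3 : ∑ χ, (IrrChar.mult (borel F).subtype (borelChar p) χ : ℂ) *
      IrrChar.mult (borel F).subtype (borelChar p') χ =
        (if p' = p then 1 else 0) + if p' = p.swap then 1 else 0 := by
    refine key.trans ((congrArg (_ * ·) (?_ : _ = ∑ h', (borelChar p' h' : ℂ) *
      ∑ x : GL (Fin 2) F, borelExt p (x * h'.1 * x⁻¹))).trans ?_)
    · refine Finset.sum_congr rfl fun h' _ => congrArg _ (Finset.sum_congr rfl fun x _ => ?_)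
      exact Finset.sum_congr rfl fun h _ => by congr!
    rw [h2, mul_assoc _ (Fintype.card F : ℂ), mul_comm (Fintype.card F : ℂ), ← h0, ← mul_assoc]
    field_simp
  exact_mod_cast h3

end

end GLTwo

noncomputable instance fintypeMonoidHomUnits (G : Type*) [CommGroup G] [Fintype G] :
    Fintype (G →* ℂˣ) := Fintype.ofFinite _

theorem card_monoidHomUnits (G : Type*) [CommGroup G] [Fintype G] :
    Fintype.card (G →* ℂˣ) = Fintype.card G := by
  rw [← Nat.card_eq_fintype_card, CommGroup.card_monoidHom_of_hasEnoughRootsOfUnity,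
    Nat.card_eq_fintype_card]

theorem sum_monoidHomUnits_inv {G : Type*} [CommGroup G] [Fintype G] [DecidableEq G] (a : G) :
    ∑ α : G →* ℂˣ, (((α a)⁻¹ : ℂˣ) : ℂ) = if a = 1 then (Fintype.card G : ℂ) else 0 := by
  split_ifs with h
  · simp [h, card_monoidHomUnits]
  · obtain ⟨φ, hφ⟩ := CommGroup.exists_apply_ne_one_of_hasEnoughRootsOfUnity G ℂ h
    have h1 : (((φ a)⁻¹ : ℂˣ) : ℂ) * ∑ α : G →* ℂˣ, (((α a)⁻¹ : ℂˣ) : ℂ) =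
        ∑ α : G →* ℂˣ, (((α a)⁻¹ : ℂˣ) : ℂ) := by
      rw [Finset.mul_sum]
      exact Fintype.sum_equiv (Equiv.mulLeft φ) _ _ fun α => by simp [mul_comm]
    refine eq_zero_of_mul_eq_self_left (b := (((φ a)⁻¹ : ℂˣ) : ℂ)) (fun h2 => hφ ?_) h1
    simpa using h2

namespace GLTwo

section

variable {F : Type} [Field F] [Fintype F] [DecidableEq F] (χ : IrrChar (GL (Fin 2) F))

theorem sum_apply_upperRightHom
    (h : ∀ p, IrrChar.mult (borel F).subtype (borelChar p) χ = 0) :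
    ∑ x : F, χ.1 (GeneralLinearGroup.upperRightHom x) = 0 := by
  have h1 (p) : ∑ b, (((borelChar p b)⁻¹ : ℂˣ) : ℂ) * χ.1 b.1 = 0 := by
    have := IrrChar.mult_eq (borel F).subtype (borelChar p) χ
    rw [h p] at this
    simpa using this.symm
  have h2 := Finset.sum_congr rfl fun p (_ : p ∈ Finset.univ) => h1 p
  rw [Finset.sum_comm, ← borelEquiv.sum_comp] at h2
  simp only [borelChar_borelEquiv, mul_inv, Units.val_mul, ← Finset.sum_mul,
    Fintype.sum_prod_type, ← Finset.mul_sum, sum_monoidHomUnits_inv] at h2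
  simp only [ite_mul, mul_ite, zero_mul, mul_zero, Finset.sum_ite_eq', Finset.mem_univ,
    if_true, Finset.sum_const_zero, Finset.sum_ite_irrel] at h2
  have h3 (x : F) : (borelEquiv ((1 : Fˣ), (1 : Fˣ), x)).1 = GeneralLinearGroup.upperRightHom x :=
    Units.ext rfl
  simp only [h3, ← Finset.mul_sum] at h2
  simpa [-GeneralLinearGroup.upperRightHom_apply] using h2

omit [Fintype F] [DecidableEq F] in
theorem apply_upperRightHom {x : F} (hx : x ≠ 0) :
    χ.1 (GeneralLinearGroup.upperRightHom x) = χ.1 (GeneralLinearGroup.upperRightHom 1) := by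
  rw [← χ.map_conj (GeneralLinearGroup.upperRightHom 1)
    (borelEquiv (Units.mk0 x hx, (1 : Fˣ), (0 : F))).1]
  refine congrArg χ.1 (eq_mul_inv_iff_mul_eq.2 (Units.ext ?_))
  rw [Units.val_mul, Units.val_mul, coe_borelEquiv]
  ext i j
  fin_cases i <;> fin_cases j <;> simp [Matrix.mul_apply, Fin.sum_univ_two]

/-- A cuspidal irreducible character has degree a multiple of `q - 1`. -/
theorem exists_apply_one_eq_mul
    (h : ∀ p, IrrChar.mult (borel F).subtype (borelChar p) χ = 0) :
    ∃ m : ℕ, χ.1 1 = m * (Fintype.card F - 1) := by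
  obtain ⟨ψ, hψ⟩ := CommGroup.exists_apply_ne_one_of_hasEnoughRootsOfUnity (Multiplicative F) ℂ
    (a := Multiplicative.ofAdd 1) (by simp)
  set u := GeneralLinearGroup.upperRightHom (R := F) with hu
  have hsum (f : F → ℂ) : ∑ x, f x * χ.1 (u x) =
      f 0 * χ.1 1 + (∑ x, f x - f 0) * χ.1 (u 1) := by
    rw [← Finset.add_sum_erase _ _ (Finset.mem_univ 0),
      ← Finset.add_sum_erase Finset.univ f (Finset.mem_univ 0), add_sub_cancel_left, Finset.sum_mul,
      AddChar.map_zero_eq_one]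
    congr 1
    exact Finset.sum_congr rfl fun x hx => by
      rw [apply_upperRightHom χ (Finset.ne_of_mem_erase hx)]
  have h1 := (hsum 1).symm.trans (by simpa only [Pi.one_apply, one_mul] using sum_apply_upperRightHom χ h)
  have h2 := IrrChar.mult_eq u.toMonoidHom ψ χ
  have h3 : ∑ x : F, (((ψ (Multiplicative.ofAdd x))⁻¹ : ℂˣ) : ℂ) = 0 := by
    refine (Fintype.sum_equiv Multiplicative.ofAdd _ _ fun _ => rfl).trans
      (sum_hom_units_eq_zero ((Units.coeHom ℂ).comp ψ⁻¹) fun h => hψ ?_)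
    simpa using DFunLike.congr_fun h (Multiplicative.ofAdd 1)
  have h4 := hsum fun x => ((ψ (Multiplicative.ofAdd x))⁻¹ : ℂˣ)
  rw [h3] at h4
  have h5 : (IrrChar.mult u.toMonoidHom ψ χ : ℂ) =
      (Fintype.card F : ℂ)⁻¹ * (χ.1 1 - χ.1 (u 1)) := by
    rw [h2]
    refine congrArg₂ _ (by simp) ((Fintype.sum_equiv Multiplicative.toAdd _ _ fun _ => rfl).trans
      (h4.trans ?_))
    simp [sub_eq_add_neg]
  refine ⟨IrrChar.mult u.toMonoidHom ψ χ, ?_⟩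
  have hq : (Fintype.card F : ℂ) ≠ 0 := by simp
  rw [h5]
  simp at h1
  field_simp
  linear_combination h1

end

end GLTwo

namespace GLTwo

section ConjClasses

variable {F : Type} [Field F]

/-- The scalar matrix with entry `a`. -/
noncomputable def scalarMat (a : Fˣ) : GL (Fin 2) F :=
  GeneralLinearGroup.mkOfDetNeZero !![(a : F), 0; 0, a] (by simp [Matrix.det_fin_two])

/-- The companion matrix of `X ^ 2 - t * X + d`, where `p = (t, d)`. -/
noncomputable def companionMat (p : F × Fˣ) : GL (Fin 2) F :=
  GeneralLinearGroup.mkOfDetNeZero !![0, -(p.2 : F); 1, p.1] (by simp [Matrix.det_fin_two])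

theorem coe_scalarMat (a : Fˣ) :
    (scalarMat a : Matrix (Fin 2) (Fin 2) F) = !![(a : F), 0; 0, a] := rfl

theorem coe_companionMat (p : F × Fˣ) :
    (companionMat p : Matrix (Fin 2) (Fin 2) F) = !![0, -(p.2 : F); 1, p.1] := rfl

theorem isConj_iff_exists_mul_eq {g h : GL (Fin 2) F} :
    IsConj g h ↔ ∃ c : GL (Fin 2) F, (c * g : Matrix (Fin 2) (Fin 2) F) = h * c := by
  rw [isConj_iff]
  refine exists_congr fun c => ?_
  rw [mul_inv_eq_iff_eq_mul, Units.ext_iff, Units.val_mul, Units.val_mul]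

theorem eq_of_isConj_scalarMat {a b : Fˣ} (h : IsConj (scalarMat a) (scalarMat b)) : a = b := by
  obtain ⟨c, hc⟩ := isConj_iff_exists_mul_eq.1 h
  rw [coe_scalarMat, coe_scalarMat] at hc
  have h0 := congrFun₂ hc 0 0
  have h1 := congrFun₂ hc 0 1
  simp only [Matrix.mul_apply, Fin.sum_univ_two] at h0 h1
  simp at h0 h1
  by_contra hab
  have hab' : (a : F) - b ≠ 0 := fun h => hab (Units.ext (sub_eq_zero.1 h))
  have h0' : c 0 0 = 0 := by
    refine (mul_eq_zero.1 ?_).resolve_left hab'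
    linear_combination h0
  have h1' : c 0 1 = 0 := by
    refine (mul_eq_zero.1 ?_).resolve_left hab'
    linear_combination h1
  exact mul_sub_mul_ne_zero c (by rw [h0', h1']; ring)

theorem not_isConj_scalarMat_companionMat (a : Fˣ) (p : F × Fˣ) :
    ¬ IsConj (scalarMat a) (companionMat p) := by
  intro h
  obtain ⟨c, hc⟩ := isConj_iff_exists_mul_eq.1 h
  rw [coe_scalarMat, coe_companionMat] at hc
  have h0 := congrFun₂ hc 1 0
  have h1 := congrFun₂ hc 1 1
  simp only [Matrix.mul_apply, Fin.sum_univ_two] at h0 h1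
  simp at h0 h1
  exact mul_sub_mul_ne_zero c (by linear_combination c 1 0 * h1 - c 1 1 * h0)

theorem eq_of_isConj_companionMat {p p' : F × Fˣ} (h : IsConj (companionMat p) (companionMat p')) :
    p = p' := by
  obtain ⟨c, hc⟩ := isConj_iff.1 h
  have h1 : (companionMat p).1.trace = (companionMat p').1.trace := by
    rw [← hc, Units.val_mul, Units.val_mul, Matrix.trace_units_conj]
  have h2 : (companionMat p).1.det = (companionMat p').1.det := by
    rw [← hc, Units.val_mul, Units.val_mul, Matrix.det_units_conj]
  rw [coe_companionMat, coe_companionMat] at h1 h2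
  simp [Matrix.trace_fin_two, Matrix.det_fin_two] at h1 h2
  exact Prod.ext h1 (Units.ext h2)

theorem isConj_companionMat (g : GL (Fin 2) F) (x y : F)
    (h : x * (g 1 0 * x + g 1 1 * y) - (g 0 0 * x + g 0 1 * y) * y ≠ 0) :
    IsConj (companionMat (g.1.trace, g.det)) g := by
  refine isConj_iff_exists_mul_eq.2 ⟨GeneralLinearGroup.mkOfDetNeZero
    !![x, g 0 0 * x + g 0 1 * y; y, g 1 0 * x + g 1 1 * y] (by simpa [Matrix.det_fin_two]), ?_⟩
  rw [coe_companionMat]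
  change !![_, _; _, _] * _ = g.1 * !![_, _; _, _]
  ext i j
  fin_cases i <;> fin_cases j <;>
    simp [Matrix.mul_apply, Fin.sum_univ_two, Matrix.trace_fin_two, Matrix.det_fin_two] <;> ring

theorem bijective_conjClasses : Function.Bijective
    (Sum.elim (fun a : Fˣ => ConjClasses.mk (scalarMat a))
      (fun p : F × Fˣ => ConjClasses.mk (companionMat p))) := by
  refine ⟨?_, fun c => ?_⟩
  · rintro (a | p) (b | p') h
    · exact congrArg _ (eq_of_isConj_scalarMat (ConjClasses.mk_eq_mk_iff_isConj.1 h))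
    · exact (not_isConj_scalarMat_companionMat _ _ (ConjClasses.mk_eq_mk_iff_isConj.1 h)).elim
    · exact (not_isConj_scalarMat_companionMat _ _
        (ConjClasses.mk_eq_mk_iff_isConj.1 h.symm)).elim
    · exact congrArg _ (eq_of_isConj_companionMat (ConjClasses.mk_eq_mk_iff_isConj.1 h))
  · obtain ⟨g, rfl⟩ := ConjClasses.mk_surjective c
    have key (x y : F) (h : x * (g 1 0 * x + g 1 1 * y) - (g 0 0 * x + g 0 1 * y) * y ≠ 0) :
        ∃ s, Sum.elim (fun a : Fˣ => ConjClasses.mk (scalarMat a))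
          (fun p : F × Fˣ => ConjClasses.mk (companionMat p)) s = ConjClasses.mk g :=
      ⟨Sum.inr _, ConjClasses.mk_eq_mk_iff_isConj.2 (isConj_companionMat g x y h)⟩
    by_cases h10 : g 1 0 = 0
    · by_cases h01 : g 0 1 = 0
      · by_cases h : g 1 1 = g 0 0
        · have h0 : g 0 0 ≠ 0 := fun h0 => mul_sub_mul_ne_zero g (by rw [h0, h10]; ring)
          refine ⟨Sum.inl (Units.mk0 _ h0), congrArg ConjClasses.mk (Units.ext ?_)⟩
          rw [coe_scalarMat]
          ext i j
          fin_cases i <;> fin_cases j <;> simp [h10, h01, h]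
        · refine key 1 1 ?_
          simpa [h10, h01, sub_eq_zero] using h
      · exact key 0 1 (by simpa using h01)
    · exact key 1 0 (by simpa using h10)

theorem card_conjClasses [Fintype F] [DecidableEq F] :
    Nat.card (ConjClasses (GL (Fin 2) F)) = Fintype.card F ^ 2 - 1 := by
  obtain ⟨n, hn⟩ : ∃ n, Fintype.card F = n + 1 := ⟨_, (Nat.succ_pred Fintype.card_ne_zero).symm⟩
  rw [← Nat.card_eq_of_bijective _ bijective_conjClasses, Nat.card_eq_fintype_card,
    Fintype.card_sum, Fintype.card_prod, Fintype.card_units, hn]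
  refine (Nat.sub_eq_of_eq_add ?_).symm
  rw [Nat.add_sub_cancel]
  ring

end ConjClasses

end GLTwo

section Counting

theorem exists_eq_one_of_sum_sq_eq_one {ι : Type*} {s : Finset ι} {f : ι → ℕ}
    (h : ∑ i ∈ s, f i * f i = 1) : ∃ i ∈ s, f i = 1 ∧ ∀ j ∈ s, j ≠ i → f j = 0 := by
  classical
  obtain ⟨i, hi, hi0⟩ : ∃ i ∈ s, f i * f i ≠ 0 := Finset.exists_ne_zero_of_sum_ne_zero (by simp [h])
  rw [← Finset.add_sum_erase _ _ hi] at h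
  have h1 : f i * f i = 1 := by lia
  refine ⟨i, hi, by simpa using h1, fun j hj hji => ?_⟩
  have h2 : ∑ x ∈ s.erase i, f x * f x = 0 := by lia
  simpa using Finset.sum_eq_zero_iff.1 h2 j (Finset.mem_erase.2 ⟨hji, hj⟩)

variable {I X : Type*} [Fintype I] [Fintype X] [DecidableEq I] [DecidableEq X]
  {r : ℕ} {n : X × X → I → ℕ} {deg : I → ℕ} {L : X → I}

omit [Fintype X] in
theorem exists_steinberg
    (hn : ∀ p p', ∑ χ, n p χ * n p' χ = (if p' = p then 1 else 0) + if p' = p.swap then 1 else 0)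
    (hdeg : ∀ p, ∑ χ, n p χ * deg χ = r + 2)
    (hL : ∀ α, n (α, α) (L α) = 1) (hLdeg : ∀ α, deg (L α) = 1) (α : X) :
    ∃ χ, n (α, α) χ = 1 ∧ deg χ = r + 1 ∧ ∀ χ', n (α, α) χ' ≠ 0 → χ' = L α ∨ χ' = χ := by
  have h1 := hn (α, α) (α, α)
  rw [← Finset.add_sum_erase _ _ (Finset.mem_univ (L α)), hL] at h1
  obtain ⟨χ, hχ, hχ1, h0⟩ := exists_eq_one_of_sum_sq_eq_one
    (s := Finset.univ.erase (L α)) (f := n (α, α))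
    (by simpa [Nat.add_comm 1] using h1)
  refine ⟨χ, hχ1, ?_, fun χ' h' => ?_⟩
  · have h2 := hdeg (α, α)
    rw [← Finset.add_sum_erase _ _ (Finset.mem_univ (L α)), hL, hLdeg,
      Finset.sum_eq_single_of_mem χ hχ fun j hj hji => by rw [h0 j hj hji, zero_mul], hχ1] at h2
    lia
  · by_contra! h
    exact h' (h0 χ' (by simpa using h.1) h.2)

omit [Fintype X] in
theorem exists_principalSeries
    (hn : ∀ p p', ∑ χ, n p χ * n p' χ = (if p' = p then 1 else 0) + if p' = p.swap then 1 else 0)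
    (hdeg : ∀ p, ∑ χ, n p χ * deg χ = r + 2) (p : X × X) (hp : p.1 ≠ p.2) :
    ∃ χ, n p χ = 1 ∧ deg χ = r + 2 ∧ ∀ χ', n p χ' ≠ 0 → χ' = χ := by
  have hp' : p ≠ p.swap := fun h => hp (congrArg Prod.fst h)
  obtain ⟨χ, hχ, hχ1, h0⟩ := exists_eq_one_of_sum_sq_eq_one
    (s := Finset.univ) (f := n p) (by simp [hn, hp'])
  refine ⟨χ, hχ1, ?_, fun χ' h' => ?_⟩
  · rw [← hdeg p, Finset.sum_eq_single_of_mem χ hχ fun j hj hji => by rw [h0 j hj hji, zero_mul],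
      hχ1, one_mul]
  · by_contra! h
    exact h' (h0 χ' (Finset.mem_univ _) h)

omit [Fintype I] in
theorem two_mul_card_image_offDiag {P : X × X → I}
    (hP : ∀ p p' : X × X, p.1 ≠ p.2 → p'.1 ≠ p'.2 → (P p' = P p ↔ p' = p ∨ p' = p.swap)) :
    2 * ((Finset.univ : Finset X).offDiag.image P).card + Fintype.card X =
      Fintype.card X * Fintype.card X := by
  have h1 := Finset.card_eq_sum_card_image P (Finset.univ : Finset X).offDiag
  rw [Finset.sum_const_nat (m := 2), Finset.offDiag_card] at h1
  · rw [mul_comm, ← h1, Finset.card_univ, Nat.sub_add_cancel (Nat.le_mul_self _)]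
  · intro χ hχ
    obtain ⟨p, hp, rfl⟩ := Finset.mem_image.1 hχ
    have hp : p.1 ≠ p.2 := by simpa using hp
    rw [show {p' ∈ (Finset.univ : Finset X).offDiag | P p' = P p} = {p, p.swap} from ?_]
    · exact Finset.card_pair fun h => hp (congrArg Prod.fst h)
    · ext p'
      simp only [Finset.mem_filter, Finset.mem_offDiag, Finset.mem_univ, true_and,
        Finset.mem_insert, Finset.mem_singleton]
      refine ⟨fun h => (hP p p' hp h.1).1 h.2, fun h => ?_⟩
      have hp' : p'.1 ≠ p'.2 := by
        rcases h with rfl | rfl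
        exacts [hp, hp.symm]
      exact ⟨hp', (hP p p' hp hp').2 h⟩

/-- The counting argument determining the degree distribution from the multiplicities `n p χ`
of the irreducible characters `χ` in the principal series, where `r = q - 1`. -/
theorem card_degrees (hr : 2 ≤ r) (hX : Fintype.card X = r) (hI : Fintype.card I = r * (r + 2))
    (hn : ∀ p p', ∑ χ, n p χ * n p' χ = (if p' = p then 1 else 0) + if p' = p.swap then 1 else 0)
    (hdeg : ∀ p, ∑ χ, n p χ * deg χ = r + 2)
    (hdegsq : ∑ χ, deg χ ^ 2 = r ^ 2 * (r + 1) * (r + 2))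
    (hpos : ∀ χ, 0 < deg χ)
    (hcusp : ∀ χ, (∀ p, n p χ = 0) → r ∣ deg χ)
    (hLinj : Function.Injective L)
    (hL : ∀ α, n (α, α) (L α) = 1) (hLdeg : ∀ α, deg (L α) = 1) :
    Fintype.card {χ // deg χ = 1} = r ∧ Fintype.card {χ // deg χ = r + 1} = r ∧
    2 * Fintype.card {χ // deg χ = r + 2} + r = r * r ∧
    2 * Fintype.card {χ // deg χ = r} = r * r + r := by
  choose S hS1 hSdeg hS using exists_steinberg hn hdeg hL hLdeg
  have hP0 (p : X × X) : ∃ χ, p.1 ≠ p.2 → n p χ = 1 ∧ deg χ = r + 2 ∧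
      ∀ χ', n p χ' ≠ 0 → χ' = χ := by
    by_cases hp : p.1 = p.2
    · exact ⟨L p.1, fun h => (h hp).elim⟩
    · obtain ⟨χ, h⟩ := exists_principalSeries hn hdeg p hp
      exact ⟨χ, fun _ => h⟩
  choose P hP using hP0
  have hpp (p p' : X × X) (χ : I) (h : n p χ ≠ 0) (h' : n p' χ ≠ 0) : p' = p ∨ p' = p.swap := by
    by_contra! hne
    have := hn p p'
    simp only [hne, if_false, add_zero] at this
    have := Finset.sum_eq_zero_iff.1 this χ (Finset.mem_univ _)
    simp [h, h'] at this
  have hSinj : Function.Injective S := fun α β h => by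
    have := hpp (α, α) (β, β) (S α) (by simp [hS1]) (by rw [h]; simp [hS1])
    simpa [eq_comm] using this
  have hPinj (p p' : X × X) (hp : p.1 ≠ p.2) (hp' : p'.1 ≠ p'.2) :
      P p' = P p ↔ p' = p ∨ p' = p.swap := by
    refine ⟨fun h => hpp p p' (P p) (by simp [(hP p hp).1]) (by simp [← h, (hP p' hp').1]), ?_⟩
    intro h
    have h1 : ∑ χ, n p χ * n p' χ ≠ 0 := by
      rw [hn]
      rcases h with h | h <;> simp [h]
    obtain ⟨χ, -, h2⟩ := Finset.exists_ne_zero_of_sum_ne_zero h1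
    rw [← (hP p hp).2.2 χ (left_ne_zero_of_mul h2), ← (hP p' hp').2.2 χ (right_ne_zero_of_mul h2)]
  have hC := two_mul_card_image_offDiag hPinj
  set A := Finset.univ.image L with hA
  set B := Finset.univ.image S with hB
  set C := (Finset.univ : Finset X).offDiag.image P with hC'
  have hAdeg (χ) (h : χ ∈ A) : deg χ = 1 := by
    obtain ⟨α, -, rfl⟩ := Finset.mem_image.1 h
    exact hLdeg α
  have hBdeg (χ) (h : χ ∈ B) : deg χ = r + 1 := by
    obtain ⟨α, -, rfl⟩ := Finset.mem_image.1 h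
    exact hSdeg α
  have hCdeg (χ) (h : χ ∈ C) : deg χ = r + 2 := by
    obtain ⟨p, hp, rfl⟩ := Finset.mem_image.1 h
    exact (hP p (by simpa using hp)).2.1
  have hAcard : A.card = r := by
    rw [hA, Finset.card_image_of_injective _ hLinj, Finset.card_univ, hX]
  have hBcard : B.card = r := by
    rw [hB, Finset.card_image_of_injective _ hSinj, Finset.card_univ, hX]
  have hAB : Disjoint A B := Finset.disjoint_left.2 fun χ h h' => by
    have := hAdeg χ h; have := hBdeg χ h'; lia
  have hABC : Disjoint (A ∪ B) C := Finset.disjoint_left.2 fun χ h h' => by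
    have := hCdeg χ h'
    rcases Finset.mem_union.1 h with h | h
    · have := hAdeg χ h; lia
    · have := hBdeg χ h; lia
  set R := (A ∪ B ∪ C)ᶜ with hR
  have hsum (f : I → ℕ) :
      ∑ χ ∈ A, f χ + ∑ χ ∈ B, f χ + ∑ χ ∈ C, f χ + ∑ χ ∈ R, f χ = ∑ χ, f χ := by
    rw [← Finset.sum_union hAB, ← Finset.sum_union hABC, Finset.sum_add_sum_compl]
  have hRge (χ) (h : χ ∈ R) : r ≤ deg χ := by
    refine Nat.le_of_dvd (hpos χ) (hcusp χ fun p => ?_)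
    by_contra hp
    simp only [hR, Finset.mem_compl, Finset.mem_union, not_or] at h
    by_cases hd : p.1 = p.2
    · obtain ⟨α, β⟩ := p
      obtain rfl : α = β := hd
      rcases hS α χ hp with rfl | rfl
      · exact h.1.1 (Finset.mem_image_of_mem _ (Finset.mem_univ _))
      · exact h.1.2 (Finset.mem_image_of_mem _ (Finset.mem_univ _))
    · rw [(hP p hd).2.2 χ hp] at h
      exact h.2 (Finset.mem_image_of_mem _ (by simpa using hd))
  have h1 := hsum fun _ => 1
  have h2 := hsum fun χ => deg χ ^ 2
  simp only [Finset.sum_const, smul_eq_mul, mul_one, Finset.card_univ, hAcard, hBcard, hI] at h1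
  rw [hdegsq, Finset.sum_congr rfl fun χ h => by rw [hAdeg χ h],
    Finset.sum_congr (s₁ := B) rfl fun χ h => by rw [hBdeg χ h],
    Finset.sum_congr (s₁ := C) rfl fun χ h => by rw [hCdeg χ h]] at h2
  simp only [Finset.sum_const, smul_eq_mul, hAcard, hBcard] at h2
  rw [hX] at hC
  have h3 : ∑ χ ∈ R, r ^ 2 = ∑ χ ∈ R, deg χ ^ 2 := by
    rw [Finset.sum_const, smul_eq_mul]
    zify at h1 h2 hC ⊢
    linear_combination r ^ 2 * h1 - h2 + 2 * (r + 1) * hC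
  have hRdeg (χ) (h : χ ∈ R) : deg χ = r := by
    have := (Finset.sum_eq_sum_iff_of_le fun χ h => Nat.pow_le_pow_left (hRge χ h) 2).1 h3 χ h
    exact (Nat.pow_left_injective two_ne_zero this).symm
  have hcl (χ : I) : χ ∈ A ∨ χ ∈ B ∨ χ ∈ C ∨ χ ∈ R := by
    simp only [hR, Finset.mem_compl, Finset.mem_union]; tauto
  have hcount (d : ℕ) (T : Finset I) (hT : ∀ χ, deg χ = d ↔ χ ∈ T) :
      Fintype.card {χ // deg χ = d} = T.card := by
    rw [Fintype.card_subtype]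
    congr 1
    ext χ
    simp [hT]
  rw [hcount 1 A, hcount (r + 1) B, hcount (r + 2) C, hcount r R]
  · refine ⟨hAcard, hBcard, hC, ?_⟩
    lia
  all_goals
    intro χ
    have := hAdeg χ
    have := hBdeg χ
    have := hCdeg χ
    have := hRdeg χ
    rcases hcl χ with h | h | h | h <;> grind

end Counting

namespace IrrChar

variable {G : Type} [Group G] [Fintype G] (χ : IrrChar G)

/-- The degree of an irreducible character, as a natural number. -/
noncomputable def degree : ℕ := (exists_natCast_apply_one χ).choose

theorem degree_pos : 0 < χ.degree := (exists_natCast_apply_one χ).choose_spec.1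

theorem apply_one : χ.1 1 = χ.degree := (exists_natCast_apply_one χ).choose_spec.2

theorem card_degree_eq (d : ℕ) :
    Nat.card {χ : G → ℂ // (∃ V : FDRep ℂ G, Simple V ∧ χ = V.character) ∧ χ 1 = d} =
      Fintype.card {χ : IrrChar G // χ.degree = d} := by
  rw [← Nat.card_eq_fintype_card]
  refine Nat.card_congr ((Equiv.subtypeSubtypeEquivSubtypeInter _ _).symm.trans
    (Equiv.subtypeEquivRight fun χ => ?_))
  rw [apply_one, Nat.cast_inj]

end IrrChar

namespace GLTwo

section

variable {F : Type} [Field F] [Fintype F] [DecidableEq F]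

/-- The irreducible character `α ∘ det`. -/
noncomputable def detChar (α : Fˣ →* ℂˣ) : IrrChar (GL (Fin 2) F) :=
  IrrChar.ofHom (α.comp GeneralLinearGroup.det)

theorem detChar_apply (α : Fˣ →* ℂˣ) (g : GL (Fin 2) F) :
    (detChar α).1 g = α (GeneralLinearGroup.det g) := rfl

theorem degree_detChar (α : Fˣ →* ℂˣ) : (detChar α).degree = 1 := by
  have h := (detChar α).apply_one
  rw [detChar_apply] at h
  simpa using h.symm

omit [Fintype F] [DecidableEq F] in
theorem det_borelEquiv (b : Fˣ × Fˣ × F) :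
    GeneralLinearGroup.det (borelEquiv b).1 = b.1 * b.2.1 := by
  refine Units.ext ?_
  rw [GeneralLinearGroup.val_det_apply, coe_borelEquiv]
  simp [Matrix.det_fin_two]

theorem detChar_injective : Function.Injective (detChar (F := F)) := fun α β h =>
  MonoidHom.ext fun a => Units.ext <| by
    have := congrArg (fun χ => χ.1 (borelEquiv (a, (1 : Fˣ), (0 : F))).1) h
    simpa [detChar_apply, det_borelEquiv] using this

theorem mult_detChar (α : Fˣ →* ℂˣ) :
    IrrChar.mult (borel F).subtype (borelChar (α, α)) (detChar α) = 1 := by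
  have h := IrrChar.mult_eq (borel F).subtype (borelChar (α, α)) (detChar α)
  rw [Finset.sum_congr rfl (g := fun _ => 1)] at h
  · exact_mod_cast h.trans (show _ = (1 : ℂ) by simp)
  · intro b _
    obtain ⟨b, rfl⟩ := borelEquiv.surjective b
    rw [Subgroup.subtype_apply, detChar_apply, det_borelEquiv, borelChar_borelEquiv, map_mul]
    exact Units.inv_mul _

theorem sum_mult_mul_degree (p : (Fˣ →* ℂˣ) × (Fˣ →* ℂˣ)) :
    ∑ χ, IrrChar.mult (borel F).subtype (borelChar p) χ * χ.degree = Fintype.card F + 1 := by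
  have h := IrrChar.sum_mult_mul_apply_one (borel F).subtype (borelChar p)
    (borel F).subtype_injective
  have hB : (Nat.card (borel F) : ℂ) ≠ 0 := by simp
  rw [card_GLTwo, Nat.cast_mul, inv_mul_cancel_left₀ hB] at h
  simp only [IrrChar.apply_one] at h
  exact_mod_cast h

theorem dvd_degree (χ : IrrChar (GL (Fin 2) F))
    (h : ∀ p, IrrChar.mult (borel F).subtype (borelChar p) χ = 0) :
    Fintype.card F - 1 ∣ χ.degree := by
  obtain ⟨m, hm⟩ := exists_apply_one_eq_mul χ h
  rw [χ.apply_one, ← Nat.cast_one, ← Nat.cast_sub Fintype.card_pos] at hm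
  exact ⟨m, by rw [mul_comm]; exact_mod_cast hm⟩

theorem card_degree {r : ℕ} (hr : 2 ≤ r) (hF : Fintype.card F = r + 1) :
    Fintype.card {χ : IrrChar (GL (Fin 2) F) // χ.degree = 1} = r ∧
    Fintype.card {χ : IrrChar (GL (Fin 2) F) // χ.degree = r + 1} = r ∧
    2 * Fintype.card {χ : IrrChar (GL (Fin 2) F) // χ.degree = r + 2} + r = r * r ∧
    2 * Fintype.card {χ : IrrChar (GL (Fin 2) F) // χ.degree = r} = r * r + r := by
  classical
  convert card_degrees (n := fun p => IrrChar.mult (borel F).subtype (borelChar p))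
    (deg := IrrChar.degree) (L := detChar) hr ?_ ?_ (fun p p' => ?_) (fun p => ?_) ?_
    IrrChar.degree_pos (fun χ h => ?_) detChar_injective mult_detChar degree_detChar
  · rw [card_monoidHomUnits, Fintype.card_units, hF, Nat.add_sub_cancel]
  · rw [IrrChar.card_eq, card_conjClasses, hF]
    exact Nat.sub_eq_of_eq_add (by ring)
  · convert sum_mult_borelChar p p'
  · rw [sum_mult_mul_degree, hF]
  · have h := IrrChar.sum_apply_one_sq (G := GL (Fin 2) F)
    simp only [IrrChar.apply_one] at h
    rw [card_GLTwo, card_borel, hF, Nat.add_sub_cancel] at h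
    exact_mod_cast h
  · have := dvd_degree χ h
    rwa [hF, Nat.add_sub_cancel] at this

end

end GLTwo

/-- Degree distribution of the irreducible complex characters of `GL_2(𝔽_q)`, `q` odd:
`q−1` of degree `1`, `q−1` of degree `q`, `(q−1)(q−2)/2` of degree `q+1`,
`q(q−1)/2` of degree `q−1`, and `q²−1` in total. -/
theorem stmt18 (q : ℕ) (hq : Odd q) (hqpp : IsPrimePow q)
    (F : Type) [Field F] [Fintype F] [DecidableEq F] (hF : Fintype.card F = q) :
    Nat.card {χ : GL (Fin 2) F → ℂ //
        (∃ V : FDRep ℂ (GL (Fin 2) F), Simple V ∧ χ = V.character) ∧ χ 1 = 1} = q - 1 ∧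
    Nat.card {χ : GL (Fin 2) F → ℂ //
        (∃ V : FDRep ℂ (GL (Fin 2) F), Simple V ∧ χ = V.character) ∧ χ 1 = (q : ℂ)} = q - 1 ∧
    Nat.card {χ : GL (Fin 2) F → ℂ //
        (∃ V : FDRep ℂ (GL (Fin 2) F), Simple V ∧ χ = V.character) ∧ χ 1 = (q : ℂ) + 1} =
      (q - 1) * (q - 2) / 2 ∧
    Nat.card {χ : GL (Fin 2) F → ℂ //
        (∃ V : FDRep ℂ (GL (Fin 2) F), Simple V ∧ χ = V.character) ∧ χ 1 = (q : ℂ) - 1} =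
      q * (q - 1) / 2 ∧
    Nat.card {χ : GL (Fin 2) F → ℂ //
        ∃ V : FDRep ℂ (GL (Fin 2) F), Simple V ∧ χ = V.character} = q ^ 2 - 1 := by
  obtain ⟨r, rfl⟩ : ∃ r, q = r + 1 := ⟨q - 1, (Nat.succ_pred hq.pos.ne').symm⟩
  have hr : 2 ≤ r := by
    have := hqpp.one_lt
    obtain ⟨k, hk⟩ := hq
    lia
  obtain ⟨h1, h2, h3, h4⟩ := GLTwo.card_degree hr hF
  have hd (d : ℕ) (x : ℂ) (hx : x = d) := hx ▸ IrrChar.card_degree_eq (G := GL (Fin 2) F) d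
  rw [hd 1 1 (by simp), hd (r + 1) _ rfl, hd (r + 2) _ (by push_cast; ring),
    hd r _ (by push_cast; ring), h1, h2]
  refine ⟨by simp, by simp, ?_, ?_, ?_⟩
  · obtain ⟨s, rfl⟩ : ∃ s, r = s + 1 := ⟨r - 1, by lia⟩
    rw [show (s + 1 + 1 - 1) * (s + 1 + 1 - 2) = (s + 1) * s from rfl]
    refine (Nat.div_eq_of_eq_mul_right two_pos ?_).symm
    lia
  · refine (Nat.div_eq_of_eq_mul_right two_pos ?_).symm
    rw [h4, Nat.add_sub_cancel]
    ring
  · rw [← hF, ← GLTwo.card_conjClasses, ← IrrChar.card_eq, Nat.card_eq_fintype_card]
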